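/- arXiv:2602.10104 — 2 statements merged into one kernel-verified Lean document; each statement's English description precedes it below -/
import Mathlib

section
/- Let n be a natural number and let R be an n × n real orthogonal matrix such that for every diagonal matrix D with positive diagonal entries, the matrix R * D * Rᵀ is diagonal. Then R is a signed permutation matrix: there exist a permutation σ of Fin n and a sign function ε : Fin n → ℝ with ε i ∈ {-1, 1} for all i, such that R i j = ε i if j = σ i and R i j = 0 otherwise. -/
open Matrix

/-- If `R` is orthogonal and `R * D * Rᵀ` is diagonal for every positive diagonal matrix `D`, then
each column of `R` has at most one nonzero entry. -/
theorem mul_eq_zero_of_preserves_isDiag {m : Type*} [Fintype m] [DecidableEq m]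
    {R : Matrix m m ℝ} (hR : R * Rᵀ = 1)
    (h : ∀ D : Matrix m m ℝ, D.IsDiag → (∀ i, 0 < D i i) → (R * D * Rᵀ).IsDiag)
    {i j : m} (hij : i ≠ j) (k : m) : R i k * R j k = 0 := by
  have hD := h (1 + diagonal (Pi.single k 1)) (isDiag_one.add (isDiag_diagonal _)) (fun l => by
    by_cases hl : l = k <;> simp [hl]) hij
  rw [mul_add, mul_one, add_mul, hR, Matrix.add_apply, one_apply_ne hij, zero_add, mul_apply] at hD
  simpa [mul_diagonal, Pi.single_apply] using hD

/-- If a real orthogonal matrix `R` keeps `R * D * Rᵀ` diagonal for every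
diagonal matrix `D` with positive diagonal entries, then `R` is a signed
permutation matrix. -/
theorem orthogonal_preserving_diag_is_signed_perm {n : ℕ}
    (R : Matrix (Fin n) (Fin n) ℝ) (hR : R * Rᵀ = 1)
    (h : ∀ D : Matrix (Fin n) (Fin n) ℝ,
      D.IsDiag → (∀ i, 0 < D i i) → (R * D * Rᵀ).IsDiag) :
    ∃ (σ : Equiv.Perm (Fin n)) (ε : Fin n → ℝ),
      (∀ i, ε i = -1 ∨ ε i = 1) ∧
      (∀ i j, R i j = if j = σ i then ε i else 0) := by
  have row_norm (i : Fin n) : ∑ k, R i k * R i k = 1 := by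
    simpa [mul_apply] using congrFun (congrFun hR i) i
  have exists_ne (i : Fin n) : ∃ k, R i k ≠ 0 := by
    by_contra! hzero
    simpa [hzero] using row_norm i
  choose f hf using exists_ne
  have f_inj : Function.Injective f := by
    intro i j hij
    by_contra hne
    have hmul := mul_eq_zero_of_preserves_isDiag hR h hne (f i)
    exact mul_ne_zero (hf i) (hij ▸ hf j) hmul
  have eq_zero (i j : Fin n) (hj : j ≠ f i) : R i j = 0 := by
    obtain ⟨l, rfl⟩ := Finite.surjective_of_injective f_inj j
    have hil : i ≠ l := fun hil => hj (congrArg f hil.symm)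
    exact (mul_eq_zero.mp (mul_eq_zero_of_preserves_isDiag hR h hil (f l))).resolve_right (hf l)
  refine ⟨Equiv.ofBijective f (Finite.injective_iff_bijective.mp f_inj), fun i => R i (f i),
    fun i => ?_, fun i j => ?_⟩
  · have hrow := row_norm i
    rw [Finset.sum_eq_single (f i) (fun k _ hk => by simp [eq_zero i k hk]) (by simp)] at hrow
    exact (mul_self_eq_one_iff.mp hrow).symm
  · rw [Equiv.ofBijective_apply]
    split_ifs with hj
    · rw [hj]
    · exact eq_zero i j hj
end

section
/- Let n be a natural number, let R be an n × n real orthogonal matrix, and let D be a diagonal matrix whose diagonal entries are pairwise distinct. If R * D * Rᵀ is diagonal, then every row of R has exactly one nonzero entry. -/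
open Matrix

/-- If `R` is orthogonal, `D` is diagonal with pairwise distinct diagonal
entries, and `R * D * Rᵀ` is diagonal, then every row of `R` has exactly one
nonzero entry. -/
theorem orthogonal_conj_diag_row_support {n : ℕ}
    (R D : Matrix (Fin n) (Fin n) ℝ) (hR : R * Rᵀ = 1)
    (hD : D.IsDiag) (hdist : ∀ i j : Fin n, i ≠ j → D i i ≠ D j j)
    (hconj : (R * D * Rᵀ).IsDiag) :
    ∀ i : Fin n, ∃! j : Fin n, R i j ≠ 0 := by
  have hcomm : (R * D * Rᵀ) * R = R * D := by
    rw [Matrix.mul_assoc, mul_eq_one_comm.mp hR, Matrix.mul_one]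
  have hentry : ∀ i j, R i j ≠ 0 → (R * D * Rᵀ) i i = D j j := by
    intro i j hij
    have h := congrFun (congrFun hcomm i) j
    rw [← hconj.diagonal_diag, diagonal_mul] at h
    nth_rewrite 2 [← hD.diagonal_diag] at h
    rw [mul_diagonal, mul_comm] at h
    exact mul_left_cancel₀ hij h
  intro i
  have hex : ∃ j, R i j ≠ 0 := by
    by_contra! h
    have hii := congrFun (congrFun hR i) i
    simp [Matrix.mul_apply, h] at hii
  obtain ⟨j, hj⟩ := hex
  refine ⟨j, hj, fun k hk => ?_⟩
  by_contra hkj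
  exact hdist k j hkj ((hentry i k hk).symm.trans (hentry i j hj))
end
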